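/- For integers l ≥ 0 and n such that n − l − 1 ≥ 0, the following identity holds: Y_{n−l−1}⋯Y_{n−1} + Σ_{i=1}^{l+1} Y_{n−l−1}⋯Y_{n−i−1} · binom_q(n+1,i) · Y₀⋯Y_{i−1} = binom_q(n,l+1) · Y₀⋯Y_l + Y_n · (Σ_{i=1}^{l+1} Y_{n−l−1}⋯Y_{n−i−1} · binom_q(n,i−1) · Y₀⋯Y_{i−2}) + (β−ε₂) · (Σ_{i=0}^{l} q^{n−i−1} Y_{n−l−1}⋯Y_{n−i−2} · binom_q(n,i) · Y₀⋯Y_{i−1}), where empty products equal 1. -/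

import Mathlib

noncomputable section

open Finset

/-- The base ring `R = ℤ[α, β, ε₁, ε₂, q]`, with variables
`av = α`, `bv = β`, `e1v = ε₁`, `e2v = ε₂`, `qv = q`. -/
abbrev R : Type := MvPolynomial (Fin 5) ℤ

def av : R := MvPolynomial.X 0
def bv : R := MvPolynomial.X 1
def e1v : R := MvPolynomial.X 2
def e2v : R := MvPolynomial.X 3
def qv : R := MvPolynomial.X 4

/-- `[n]_q = 1 + q + ⋯ + q^(n-1)`. -/
def qnum (n : ℕ) : R := ∑ i ∈ Finset.range n, qv ^ i

/-- The Gaussian (q-)binomial coefficient. -/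
def qbinom : ℕ → ℕ → R
  | _, 0 => 1
  | 0, _ + 1 => 0
  | n + 1, k + 1 => qbinom n k + qv ^ (k + 1) * qbinom n (k + 1)

/-- `X_i = α q^i + ε₁ [i]_q`. -/
def Xv (i : ℕ) : R := av * qv ^ i + e1v * qnum i

/-- `Y_i = β q^i + ε₂ [i]_q`. -/
def Yv (i : ℕ) : R := bv * qv ^ i + e2v * qnum i

/-- `b_n = (α+β) q^n + (ε₁+ε₂)[n]_q`. -/
def bcoef (n : ℕ) : R := (av + bv) * qv ^ n + (e1v + e2v) * qnum n

/-- `λ_n = ε₁ε₂[n]_q[n-1]_q + (αε₂+βε₁) q^(n-1) [n]_q + αβ(q^(2n-1) - q^(n-1))` (for `n ≥ 1`). -/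
def lcoef (n : ℕ) : R :=
  e1v * e2v * qnum n * qnum (n - 1) + (av * e2v + bv * e1v) * qv ^ (n - 1) * qnum n
    + av * bv * (qv ^ (2 * n - 1) - qv ^ (n - 1))

/-- The transformed Al-Salam-Chihara polynomials. -/
def phat : ℕ → Polynomial R
  | 0 => 1
  | 1 => Polynomial.X + Polynomial.C (bcoef 0)
  | n + 2 => (Polynomial.X + Polynomial.C (bcoef (n + 1))) * phat (n + 1)
      - Polynomial.C (lcoef (n + 1)) * phat n

/-- `g m i` is the coefficient of `x^i` in `p̂_m(x)`. -/
def g (m i : ℕ) : R := (phat m).coeff i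

theorem qbinom_zero_right (n : ℕ) : qbinom n 0 = 1 := by
  cases n <;> simp [qbinom]

theorem qbinom_succ (n k : ℕ) :
    qbinom (n + 1) (k + 1) = qbinom n k + qv ^ (k + 1) * qbinom n (k + 1) := by
  simp [qbinom]

theorem qbinom_eq_zero (n : ℕ) : ∀ k, n < k → qbinom n k = 0 := by
  induction n with
  | zero => intro k hk; obtain ⟨k, rfl⟩ := Nat.exists_eq_succ_of_ne_zero hk.ne'; simp [qbinom]
  | succ n ih =>
    intro k hk
    obtain ⟨k, rfl⟩ := Nat.exists_eq_succ_of_ne_zero (by omega : k ≠ 0)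
    rw [Nat.succ_eq_add_one, qbinom_succ, ih k (by omega), ih (k + 1) (by omega)]
    simp

theorem qbinom_succ' (n : ℕ) : ∀ k d, n = k + d →
    qbinom (n + 1) (k + 1) = qv ^ d * qbinom n k + qbinom n (k + 1) := by
  induction n with
  | zero =>
    intro k d h
    obtain rfl : k = 0 := by omega
    obtain rfl : d = 0 := by omega
    simp [qbinom]
  | succ n ih =>
    intro k d h
    rcases k with _ | j
    · obtain rfl : d = n + 1 := by omega
      have h1 := ih 0 n (by omega)
      have h2 := qbinom_succ n 0
      have h3 := qbinom_succ (n + 1) 0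
      simp only [qbinom_zero_right] at *
      linear_combination h3 + (qv - 1) * h1 + (h1 - h2)
    · rcases d with _ | d
      · rw [qbinom_succ, qbinom_eq_zero (n + 1) (j + 1 + 1) (by omega)]; simp
      · have h1 := ih j (d + 1) (by omega)
        have h2 := ih (j + 1) d (by omega)
        have h3 := qbinom_succ (n + 1) (j + 1)
        have h4 := qbinom_succ n j
        have h5 := qbinom_succ n (j + 1)
        linear_combination h3 + h1 + qv ^ (j + 2) * h2 - qv ^ (d + 1) * h4 - h5

theorem Yv_rel (a i : ℕ) :
    Yv a + qv ^ (a + 1) * Yv i = Yv (a + 1 + i) + (bv - e2v) * qv ^ a := by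
  simp only [Yv, qnum, Finset.sum_range_add, Finset.sum_range_one, pow_add, ← Finset.mul_sum]
  ring

/-- **Lemma `219`.** For `l ≥ 0` and `n` with `n − l − 1 ≥ 0`:
`Y_{n−l−1}⋯Y_{n−1} + Σ_{i=1}^{l+1} Y_{n−l−1}⋯Y_{n−i−1} binom_q(n+1,i) Y₀⋯Y_{i−1}
 = binom_q(n,l+1) Y₀⋯Y_l + Y_n (Σ_{i=1}^{l+1} Y_{n−l−1}⋯Y_{n−i−1} binom_q(n,i−1) Y₀⋯Y_{i−2})
   + (β−ε₂)(Σ_{i=0}^{l} q^{n−i−1} Y_{n−l−1}⋯Y_{n−i−2} binom_q(n,i) Y₀⋯Y_{i−1})`. -/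
theorem product_sum_identity (l n : ℕ) (h : l + 1 ≤ n) :
    (∏ t ∈ Finset.range (l + 1), Yv (n - l - 1 + t)) +
        ∑ i ∈ Finset.Icc 1 (l + 1),
          (∏ t ∈ Finset.range (l + 1 - i), Yv (n - l - 1 + t)) * qbinom (n + 1) i *
            ∏ j ∈ Finset.range i, Yv j =
      qbinom n (l + 1) * (∏ j ∈ Finset.range (l + 1), Yv j) +
        Yv n *
          (∑ i ∈ Finset.Icc 1 (l + 1),
            (∏ t ∈ Finset.range (l + 1 - i), Yv (n - l - 1 + t)) * qbinom n (i - 1) *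
              ∏ j ∈ Finset.range (i - 1), Yv j) +
        (bv - e2v) *
          (∑ i ∈ Finset.range (l + 1),
            qv ^ (n - i - 1) * (∏ t ∈ Finset.range (l - i), Yv (n - l - 1 + t)) *
              qbinom n i * ∏ j ∈ Finset.range i, Yv j) := by
  obtain ⟨m, rfl⟩ := Nat.exists_eq_add_of_le' h
  have hm : m + (l + 1) - l - 1 = m := by omega
  simp only [hm]
  have e : ∀ f : ℕ → R, ∑ i ∈ Finset.Icc 1 (l + 1), f i = ∑ i ∈ Finset.range (l + 1), f (i + 1) := by
    intro f
    rw [Finset.range_eq_Ico, Finset.sum_Ico_add' f 0 (l + 1) 1]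
    rfl
  rw [e, e]
  simp only [Nat.add_sub_cancel, Nat.add_sub_add_right]
  have key : ∑ i ∈ Finset.range (l + 1 + 1), (∏ t ∈ Finset.range (l + 1 - i), Yv (m + t)) *
      qbinom (m + (l + 1)) i * ∏ j ∈ Finset.range i, Yv j =
      ∑ i ∈ Finset.range (l + 1 + 1), (∏ t ∈ Finset.range (l + 1 - i), Yv (m + t)) *
      qbinom (m + (l + 1)) i * ∏ j ∈ Finset.range i, Yv j := rfl
  conv_lhs at key => rw [Finset.sum_range_succ']
  conv_rhs at key => rw [Finset.sum_range_succ]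
  simp only [Nat.add_sub_add_right, Nat.sub_self, Nat.sub_zero, Finset.prod_range_zero,
    qbinom_zero_right, one_mul, mul_one] at key
  have A : ∀ i ∈ Finset.range (l + 1),
      (∏ t ∈ Finset.range (l - i), Yv (m + t)) * qbinom (m + (l + 1) + 1) (i + 1) *
        ∏ j ∈ Finset.range (i + 1), Yv j =
      (∏ t ∈ Finset.range (l - i), Yv (m + t)) * qbinom (m + (l + 1)) (i + 1) *
        ∏ j ∈ Finset.range (i + 1), Yv j +
      (Yv (m + (l + 1)) * ((∏ t ∈ Finset.range (l - i), Yv (m + t)) * qbinom (m + (l + 1)) i *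
        ∏ j ∈ Finset.range i, Yv j) +
      (bv - e2v) * (qv ^ (m + (l + 1) - i - 1) * (∏ t ∈ Finset.range (l - i), Yv (m + t)) *
        qbinom (m + (l + 1)) i * ∏ j ∈ Finset.range i, Yv j) -
      (∏ t ∈ Finset.range (l + 1 - i), Yv (m + t)) * qbinom (m + (l + 1)) i *
        ∏ j ∈ Finset.range i, Yv j) := by
    intro i hi
    obtain ⟨d, rfl⟩ := Nat.exists_eq_add_of_le' (Nat.lt_succ_iff.mp (Finset.mem_range.mp hi))
    have h1 : d + i - i = d := by omega
    have h2 : d + i + 1 - i = d + 1 := by omega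
    have h3 : m + (d + i + 1) - i - 1 = m + d := by omega
    have h4 := Yv_rel (m + d) i
    have h5 : m + d + 1 + i = m + (d + i + 1) := by omega
    rw [h5] at h4
    rw [h1, h2, h3, qbinom_succ' _ i (m + d + 1) (by omega), Finset.prod_range_succ _ i,
      Finset.prod_range_succ _ d]
    linear_combination ((∏ t ∈ Finset.range d, Yv (m + t)) * qbinom (m + (d + i + 1)) i *
        ∏ j ∈ Finset.range i, Yv j) * h4
  rw [Finset.sum_congr rfl A, Finset.sum_add_distrib, Finset.sum_sub_distrib,
    Finset.sum_add_distrib, ← Finset.mul_sum, ← Finset.mul_sum]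
  linear_combination key
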